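/- arXiv:1003.1210 — 2 statements merged into one kernel-verified Lean document; each statement's English description precedes it below -/
import Mathlib

section
/- Let k ∈ ℕ, r > 0, and for each n ∈ ℕ let G_n : ℂ → ℂ be analytic on the open disc {|z| < r}; set g_n(z) := G_n(z)/z^{k+1} for 0 < |z| < r. Assume that the series F(z) := Σ_{n=0}^∞ (z^n/n!) · g_n(z) converges locally uniformly on the punctured disc {0 < |z| < r}. Then for every integer j with −1 ≤ j ≤ k and every ρ with 0 < ρ < r one has (1/(2πi)) ∮_{|z|=ρ} z^j F(z) dz = Σ_{n=0}^{k−j} (1/n!) · G_n^{(k−j−n)}(0)/(k−j−n)!, i.e. Res₀^{j+1} F = Σ_{n=0}^{k−j} (1/n!) · Res₀^{j+n+1} g_n; moreover for every n > k−j the integral ∮_{|z|=ρ} z^{j+n} g_n(z) dz vanishes. -/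
open Filter Metric

/-- Multiplication by `z ^ j`, which has constant norm on a circle around `0`, preserves uniform
convergence on that circle. -/
lemma TendstoUniformlyOn.zpow_mul_sphere {ι : Type*} {l : Filter ι} {f : ι → ℂ → ℂ} {g : ℂ → ℂ}
    {ρ : ℝ} (hρ : 0 < ρ) (j : ℤ) (h : TendstoUniformlyOn f g l (sphere 0 ρ)) :
    TendstoUniformlyOn (fun i z => z ^ j * f i z) (fun z => z ^ j * g z) l (sphere 0 ρ) := by
  rw [Metric.tendstoUniformlyOn_iff] at h ⊢
  intro ε hε
  have hpos : 0 < ρ ^ j := zpow_pos hρ j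
  filter_upwards [h (ε / ρ ^ j) (div_pos hε hpos)] with i hi z hz
  have hnorm : ‖z‖ = ρ := by simpa using hz
  have := hi z hz
  rw [dist_eq_norm] at this ⊢
  rwa [← mul_sub, norm_mul, norm_zpow, hnorm, mul_comm, ← lt_div_iff₀ hpos]

/-- A function with a pole of order at most `k + 1` at `0`, multiplied by a power of `z` that
cancels the pole, has vanishing circle integral. -/
lemma circleIntegral_zpow_mul_div_pow_eq_zero {k : ℕ} {ρ : ℝ} (hρ : 0 < ρ) {g : ℂ → ℂ}
    (hg : DifferentiableOn ℂ g (closedBall 0 ρ)) {a : ℤ} (ha : (k : ℤ) < a) :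
    (∮ z in C(0, ρ), z ^ a * (g z / z ^ (k + 1))) = 0 := by
  obtain ⟨b, rfl⟩ : ∃ b : ℕ, a = (k + 1 : ℕ) + b :=
    ⟨(a - (k + 1)).toNat, by push_cast; omega⟩
  have hcongr : Set.EqOn (fun z : ℂ => z ^ (((k + 1 : ℕ) : ℤ) + b) * (g z / z ^ (k + 1)))
      (fun z => z ^ b * g z) (sphere 0 ρ) := by
    intro z hz
    have hz0 : z ≠ 0 := ne_of_mem_sphere hz hρ.ne'
    simp only
    rw [zpow_add₀ hz0, zpow_natCast, zpow_natCast]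
    field_simp
  rw [circleIntegral.integral_congr hρ.le hcongr]
  have hd : DifferentiableOn ℂ (fun z => z ^ b * g z) (closedBall 0 ρ) :=
    (differentiable_id.pow b).differentiableOn.mul hg
  exact (hd.mono closure_ball_subset_closedBall).diffContOnCl.circleIntegral_eq_zero hρ.le

/-- The residues at `0` of a function with a pole of order at most `k + 1` are Taylor coefficients
of its numerator. -/
lemma circleIntegral_zpow_mul_div_pow {k : ℕ} {ρ : ℝ} (hρ : 0 < ρ) {g : ℂ → ℂ}
    (hg : DifferentiableOn ℂ g (closedBall 0 ρ)) {a : ℤ} {d : ℕ} (had : a + d = k) :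
    (∮ z in C(0, ρ), z ^ a * (g z / z ^ (k + 1))) =
      2 * (Real.pi : ℂ) * Complex.I * (iteratedDeriv d g 0 / (d.factorial : ℂ)) := by
  have hcongr : Set.EqOn (fun z : ℂ => z ^ a * (g z / z ^ (k + 1)))
      (fun z => (1 / (z - 0) ^ (d + 1)) • g z) (sphere 0 ρ) := by
    intro z hz
    have hz0 : z ≠ 0 := ne_of_mem_sphere hz hρ.ne'
    have hpow : z ^ a * z ^ (d + 1) = z ^ (k + 1) := by
      rw [← zpow_natCast, ← zpow_natCast, ← zpow_add₀ hz0]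
      congr 1
      push_cast
      omega
    simp only [sub_zero, smul_eq_mul, ← hpow]
    have := zpow_ne_zero a hz0
    field_simp
  rw [circleIntegral.integral_congr hρ.le hcongr,
    hg.circleIntegral_one_div_sub_center_pow_smul hρ d, smul_eq_mul]
  ring

/-- Let `k ∈ ℕ`, `r > 0`, and for each `n` let `Gₙ` be analytic on the disc
`{|z| < r}`; set `gₙ(z) := Gₙ(z)/z^(k+1)`.  If `F(z) = ∑ₙ (zⁿ/n!) gₙ(z)` converges locally
uniformly on the punctured disc `{0 < |z| < r}`, then for every integer `j` with `-1 ≤ j ≤ k`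
and every `0 < ρ < r`,
`(2πi)⁻¹ ∮_{|z|=ρ} z^j F(z) dz = ∑_{n=0}^{k-j} (1/n!) · Gₙ^{(k-j-n)}(0)/(k-j-n)!`,
and for every `n > k - j` the integral `∮_{|z|=ρ} z^{j+n} gₙ(z) dz` vanishes. -/
theorem statement0
    (k : ℕ) (r : ℝ) (hr : 0 < r)
    (G : ℕ → ℂ → ℂ) (hG : ∀ n, AnalyticOnNhd ℂ (G n) (Metric.ball (0 : ℂ) r))
    (F : ℂ → ℂ)
    (hF : TendstoLocallyUniformlyOn
      (fun N z => ∑ n ∈ Finset.range N, z ^ n / (n.factorial : ℂ) * (G n z / z ^ (k + 1)))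
      F Filter.atTop {z : ℂ | 0 < ‖z‖ ∧ ‖z‖ < r}) :
    ∀ j : ℤ, -1 ≤ j → j ≤ (k : ℤ) → ∀ ρ : ℝ, 0 < ρ → ρ < r →
      ((2 * (Real.pi : ℂ) * Complex.I)⁻¹ * ∮ z in C(0, ρ), z ^ j * F z) =
        ∑ n ∈ Finset.range (((k : ℤ) - j).toNat + 1),
          (1 / (n.factorial : ℂ)) *
            (iteratedDeriv (((k : ℤ) - j).toNat - n) (G n) 0 /
              (((((k : ℤ) - j).toNat - n).factorial : ℂ))) ∧
      ∀ n : ℕ, (k : ℤ) - j < (n : ℤ) →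
        (∮ z in C(0, ρ), z ^ (j + (n : ℤ)) * (G n z / z ^ (k + 1))) = 0 := by
  intro j _ hjk ρ hρ hρr
  have hd : ∀ n, DifferentiableOn ℂ (G n) (closedBall 0 ρ) := fun n =>
    (hG n).differentiableOn.mono (closedBall_subset_ball hρr)
  refine ⟨?_, fun n hn => circleIntegral_zpow_mul_div_pow_eq_zero hρ (hd n) (by omega)⟩
  obtain ⟨m, hm⟩ : ∃ m : ℕ, (k : ℤ) - j = m := ⟨((k : ℤ) - j).toNat, by omega⟩
  rw [hm, Int.toNat_natCast]
  have hsphere : sphere (0 : ℂ) ρ ⊆ {z : ℂ | 0 < ‖z‖ ∧ ‖z‖ < r} := by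
    intro z hz
    have hnorm : ‖z‖ = ρ := by simpa using hz
    exact ⟨hnorm ▸ hρ, hnorm ▸ hρr⟩
  have hunif := ((tendstoLocallyUniformlyOn_iff_tendstoUniformlyOn_of_compact
    (isCompact_sphere (0 : ℂ) ρ)).1 (hF.mono hsphere)).zpow_mul_sphere hρ j
  have hcont : ∀ (a : ℤ) n,
      ContinuousOn (fun z : ℂ => z ^ a * (G n z / z ^ (k + 1))) (sphere 0 ρ) := by
    intro a n z hz
    have hz0 : z ≠ 0 := ne_of_mem_sphere hz hρ.ne'
    exact (continuousAt_zpow₀ z a (Or.inl hz0)).continuousWithinAt.mul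
      ((((hd n).continuousOn.mono sphere_subset_closedBall) z hz).div
        (continuous_pow (k + 1)).continuousWithinAt (pow_ne_zero _ hz0))
  have hsum : ∀ N, Set.EqOn
      (fun z : ℂ => z ^ j *
        ∑ n ∈ Finset.range N, z ^ n / (n.factorial : ℂ) * (G n z / z ^ (k + 1)))
      (fun z => ∑ n ∈ Finset.range N,
        1 / (n.factorial : ℂ) * (z ^ (j + (n : ℤ)) * (G n z / z ^ (k + 1)))) (sphere 0 ρ) := by
    intro N z hz
    have hz0 : z ≠ 0 := ne_of_mem_sphere hz hρ.ne'
    simp only [Finset.mul_sum]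
    refine Finset.sum_congr rfl fun n _ => ?_
    rw [zpow_add₀ hz0, zpow_natCast]
    ring
  have hterm : ∀ n : ℕ, ContinuousOn (fun z : ℂ =>
      1 / (n.factorial : ℂ) * (z ^ (j + (n : ℤ)) * (G n z / z ^ (k + 1)))) (sphere 0 ρ) :=
    fun n => continuousOn_const.mul (hcont _ n)
  have hcontsum : ∀ N, ContinuousOn
      (fun z : ℂ => ∑ n ∈ Finset.range N,
        1 / (n.factorial : ℂ) * (z ^ (j + (n : ℤ)) * (G n z / z ^ (k + 1)))) (sphere 0 ρ) :=
    fun N => continuousOn_finsetSum _ fun n _ => hterm n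
  have hlim := hunif.tendsto_circleIntegral_of_continuousOn hρ.le
    (Eventually.of_forall fun N => (hcontsum N).congr (hsum N))
  have hpartial : ∀ N, m + 1 ≤ N →
      (∮ z in C(0, ρ), z ^ j *
        ∑ n ∈ Finset.range N, z ^ n / (n.factorial : ℂ) * (G n z / z ^ (k + 1))) =
      2 * (Real.pi : ℂ) * Complex.I * ∑ n ∈ Finset.range (m + 1),
        1 / (n.factorial : ℂ) * (iteratedDeriv (m - n) (G n) 0 / ((m - n).factorial : ℂ)) := by
    intro N hN
    rw [circleIntegral.integral_congr hρ.le (hsum N), circleIntegral.integral_fun_sum fun n _ =>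
      (hterm n).circleIntegrable hρ.le, Finset.mul_sum]
    simp only [circleIntegral.integral_const_mul]
    rw [← Finset.sum_subset (Finset.range_subset_range.2 hN)]
    · refine Finset.sum_congr rfl fun n hn => ?_
      rw [Finset.mem_range] at hn
      rw [circleIntegral_zpow_mul_div_pow hρ (hd n) (d := m - n) (by omega)]
      ring
    · intro n _ hn
      rw [Finset.mem_range] at hn
      rw [circleIntegral_zpow_mul_div_pow_eq_zero hρ (hd n) (by omega), mul_zero]
  have hF_int := tendsto_nhds_unique hlim
    (tendsto_const_nhds.congr'
      ((eventually_ge_atTop (m + 1)).mono fun N hN => (hpartial N hN).symm))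
  rw [hF_int, inv_mul_cancel_left₀ Complex.two_pi_I_ne_zero]
end

section
/- Let k ∈ ℕ, r > 0, and for each n ∈ ℕ let G_n : ℂ → ℂ be analytic on the open disc {|z| < r}. Assume that the series Σ_{n=0}^∞ (z^n/n!) · G_n(z)/z^{k+1} converges locally uniformly on the punctured disc {0 < |z| < r} to a function F. Then F has a pole of order at most k+1 at 0: there exists Φ analytic on the open disc {|z| < r} with F(z) = Φ(z)/z^{k+1} for 0 < |z| < r, and its Taylor coefficients are given for every m ∈ ℕ by Φ^{(m)}(0)/m! = Σ_{n=0}^{m} (1/n!) · G_n^{(m−n)}(0)/(m−n)!. -/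
open Filter Metric

open scoped Topology

/-- A locally uniform limit of holomorphic functions may be differentiated any number of times. -/
theorem TendstoLocallyUniformlyOn.iteratedDeriv_of_differentiableOn {ι : Type*} {l : Filter ι}
    {f : ι → ℂ → ℂ} {g : ℂ → ℂ} {U : Set ℂ} (h : TendstoLocallyUniformlyOn f g l U)
    (hf : ∀ i, DifferentiableOn ℂ (f i) U) (hU : IsOpen U) (m : ℕ) :
    TendstoLocallyUniformlyOn (fun i => iteratedDeriv m (f i)) (iteratedDeriv m g) l U := by
  induction m with
  | zero => simpa only [iteratedDeriv_zero] using h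
  | succ m ih =>
    simp only [iteratedDeriv_succ]
    refine ih.deriv (Eventually.of_forall fun i => ?_) hU
    rw [iteratedDeriv_eq_iterate]
    exact (((hf i).analyticOnNhd hU).iterated_deriv m).differentiableOn

/-- By the maximum principle, a sequence of holomorphic functions on a disc that is uniformly Cauchy
on every concentric circle is uniformly Cauchy on every concentric closed disc. -/
theorem uniformCauchySeqOn_closedBall_of_sphere {f : ℕ → ℂ → ℂ} {c : ℂ} {r ρ : ℝ}
    (hf : ∀ n, DifferentiableOn ℂ (f n) (ball c r)) (hρ : 0 < ρ) (hρr : ρ < r)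
    (h : UniformCauchySeqOn f atTop (sphere c ρ)) :
    UniformCauchySeqOn f atTop (closedBall c ρ) := by
  rw [Metric.uniformCauchySeqOn_iff] at h ⊢
  intro ε hε
  obtain ⟨N, hN⟩ := h (ε / 2) (half_pos hε)
  refine ⟨N, fun m hm n hn z hz => ?_⟩
  have hd : DiffContOnCl ℂ (fun w => f m w - f n w) (ball c ρ) :=
    (((hf m).sub (hf n)).mono (closure_ball_subset_closedBall.trans
      (closedBall_subset_ball hρr))).diffContOnCl
  rw [dist_eq_norm]
  refine (Complex.norm_le_of_forall_mem_frontier_norm_le isBounded_ball hd (C := ε / 2)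
    (fun w hw => ?_) (by rwa [closure_ball c hρ.ne'])).trans_lt (half_lt_self hε)
  rw [frontier_ball c hρ.ne'] at hw
  simpa only [dist_eq_norm] using (hN m hm n hn w hw).le

/-- A sequence of holomorphic functions on a disc that is uniformly Cauchy on every concentric
circle converges locally uniformly on the disc. -/
theorem exists_tendstoLocallyUniformlyOn_ball_of_sphere {f : ℕ → ℂ → ℂ} {c : ℂ} {r : ℝ}
    (hf : ∀ n, DifferentiableOn ℂ (f n) (ball c r))
    (h : ∀ ρ, 0 < ρ → ρ < r → UniformCauchySeqOn f atTop (sphere c ρ)) :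
    ∃ g : ℂ → ℂ, TendstoLocallyUniformlyOn f g atTop (ball c r) := by
  have hc : ∀ ρ, 0 < ρ → ρ < r → UniformCauchySeqOn f atTop (closedBall c ρ) :=
    fun ρ h0 h1 => uniformCauchySeqOn_closedBall_of_sphere hf h0 h1 (h ρ h0 h1)
  have hmid : ∀ z ∈ ball c r, ∃ ρ, 0 < ρ ∧ ρ < r ∧ dist z c < ρ := fun z hz => by
    obtain ⟨ρ, h1, h2⟩ := exists_between (mem_ball.1 hz)
    exact ⟨ρ, dist_nonneg.trans_lt h1, h2, h1⟩
  have hlim : ∀ z ∈ ball c r, Tendsto (fun n => f n z) atTop (𝓝 (limUnder atTop fun n => f n z)) :=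
    fun z hz => by
      obtain ⟨ρ, h0, h1, h2⟩ := hmid z hz
      exact ((hc ρ h0 h1).cauchySeq (mem_closedBall.2 h2.le)).tendsto_limUnder
  refine ⟨fun z => limUnder atTop fun n => f n z, ?_⟩
  intro u hu z hz
  obtain ⟨ρ, h0, h1, h2⟩ := hmid z hz
  exact ⟨closedBall c ρ, mem_nhdsWithin_of_mem_nhds (closedBall_mem_nhds_of_mem h2),
    (hc ρ h0 h1).tendstoUniformlyOn_of_tendsto
      (fun w hw => hlim w (closedBall_subset_ball h1 hw)) u hu⟩

/-- The Taylor coefficients at `0` of `z ^ n * g z` are those of `g`, shifted by `n`. -/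
theorem iteratedDeriv_pow_mul_zero_div_factorial {g : ℂ → ℂ} (hg : AnalyticAt ℂ g 0) (n m : ℕ) :
    iteratedDeriv m (fun z => z ^ n * g z) 0 / (m.factorial : ℂ) =
      if n ≤ m then iteratedDeriv (m - n) g 0 / ((m - n).factorial : ℂ) else 0 := by
  rw [iteratedDeriv_fun_mul (by fun_prop) hg.contDiffAt]
  have hp : ∀ i, iteratedDeriv i (fun z : ℂ => z ^ n) 0 = if i = n then (n.factorial : ℂ) else 0 := by
    intro i
    rw [iteratedDeriv_pow]
    rcases lt_trichotomy i n with h | rfl | h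
    · simp [h.ne, Nat.sub_ne_zero_of_lt h]
    · simp [Nat.descFactorial_self]
    · simp [h.ne', Nat.descFactorial_of_lt h]
  simp only [hp, mul_ite, ite_mul, mul_zero, zero_mul, Finset.sum_ite_eq', Finset.mem_range,
    Nat.lt_succ_iff]
  split_ifs with h
  · rw [Nat.cast_choose ℂ h]
    have h1 : (m.factorial : ℂ) ≠ 0 := Nat.cast_ne_zero.2 m.factorial_ne_zero
    have h2 : (n.factorial : ℂ) ≠ 0 := Nat.cast_ne_zero.2 n.factorial_ne_zero
    have h3 : ((m - n).factorial : ℂ) ≠ 0 := Nat.cast_ne_zero.2 (m - n).factorial_ne_zero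
    field_simp
  · simp

/-- The `m`-th Taylor coefficient at `0` of `∑ n < N, zⁿ / n! * Gₙ z` does not depend on `N > m`. -/
theorem iteratedDeriv_sum_pow_div_factorial_mul {G : ℕ → ℂ → ℂ}
    (hG : ∀ n, AnalyticAt ℂ (G n) 0) {m N : ℕ} (hN : m + 1 ≤ N) :
    iteratedDeriv m (fun z => ∑ n ∈ Finset.range N, z ^ n / (n.factorial : ℂ) * G n z) 0 /
        (m.factorial : ℂ) =
      ∑ n ∈ Finset.range (m + 1),
        1 / (n.factorial : ℂ) * (iteratedDeriv (m - n) (G n) 0 / ((m - n).factorial : ℂ)) := by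
  have hterm : ∀ n, (fun z => z ^ n / (n.factorial : ℂ) * G n z) =
      fun z => 1 / (n.factorial : ℂ) * (z ^ n * G n z) := fun n => by ext z; ring
  rw [iteratedDeriv_fun_sum fun n _ => by
    have := (hG n).contDiffAt (n := m)
    fun_prop, Finset.sum_div]
  simp only [hterm, iteratedDeriv_const_mul_field, mul_div_assoc,
    iteratedDeriv_pow_mul_zero_div_factorial (hG _)]
  refine (Finset.sum_subset_zero_on_sdiff (Finset.range_subset_range.2 hN) ?_ ?_).symm
  · intro n hn
    rw [Finset.mem_sdiff, Finset.mem_range, Finset.mem_range] at hn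
    rw [if_neg (by omega), mul_zero]
  · intro n hn
    rw [if_pos (Nat.lt_succ_iff.1 (Finset.mem_range.1 hn))]

/-- Let `k ∈ ℕ`, `r > 0`, and for each `n` let `Gₙ` be analytic on the disc
`{|z| < r}`.  If `F(z) = ∑ₙ (zⁿ/n!) · Gₙ(z)/z^(k+1)` converges locally uniformly on the
punctured disc `{0 < |z| < r}`, then `F` has a pole of order at most `k+1` at `0`: there is a
function `Φ` analytic on the disc with `F(z) = Φ(z)/z^(k+1)` on the punctured disc, whose Taylor
coefficients are `Φ^{(m)}(0)/m! = ∑_{n=0}^{m} (1/n!) · Gₙ^{(m-n)}(0)/(m-n)!`. -/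
theorem statement1
    (k : ℕ) (r : ℝ) (hr : 0 < r)
    (G : ℕ → ℂ → ℂ) (hG : ∀ n, AnalyticOnNhd ℂ (G n) (Metric.ball (0 : ℂ) r))
    (F : ℂ → ℂ)
    (hF : TendstoLocallyUniformlyOn
      (fun N z => ∑ n ∈ Finset.range N, z ^ n / (n.factorial : ℂ) * (G n z / z ^ (k + 1)))
      F Filter.atTop {z : ℂ | 0 < ‖z‖ ∧ ‖z‖ < r}) :
    ∃ Φ : ℂ → ℂ, AnalyticOnNhd ℂ Φ (Metric.ball (0 : ℂ) r) ∧
      (∀ z : ℂ, 0 < ‖z‖ → ‖z‖ < r → F z = Φ z / z ^ (k + 1)) ∧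
      ∀ m : ℕ, iteratedDeriv m Φ 0 / (m.factorial : ℂ) =
        ∑ n ∈ Finset.range (m + 1),
          (1 / (n.factorial : ℂ)) * (iteratedDeriv (m - n) (G n) 0 / (((m - n).factorial : ℂ))) := by
  set S : ℕ → ℂ → ℂ := fun N z => ∑ n ∈ Finset.range N, z ^ n / (n.factorial : ℂ) * G n z
  have hSd : ∀ N, DifferentiableOn ℂ (S N) (ball 0 r) := fun N =>
    DifferentiableOn.fun_sum fun n _ =>
      ((differentiableOn_pow n).div_const _).mul (hG n).differentiableOn
  have hSP : ∀ N, ∀ z : ℂ, z ≠ 0 → S N z = z ^ (k + 1) *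
      ∑ n ∈ Finset.range N, z ^ n / (n.factorial : ℂ) * (G n z / z ^ (k + 1)) := by
    intro N z hz
    rw [Finset.mul_sum]
    refine Finset.sum_congr rfl fun n _ => ?_
    field_simp
  have hCauchy : ∀ ρ, 0 < ρ → ρ < r → UniformCauchySeqOn S atTop (sphere 0 ρ) := by
    intro ρ h0 h1
    have hsub : sphere (0 : ℂ) ρ ⊆ {z : ℂ | 0 < ‖z‖ ∧ ‖z‖ < r} := fun z hz => by
      rw [mem_sphere_zero_iff_norm] at hz
      rw [Set.mem_ofPred_eq, hz]
      exact ⟨h0, h1⟩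
    have hu := ((tendstoLocallyUniformlyOn_iff_tendstoUniformlyOn_of_compact
      (isCompact_sphere 0 ρ)).1 (hF.mono hsub)).uniformCauchySeqOn
    rw [Metric.uniformCauchySeqOn_iff] at hu ⊢
    intro ε hε
    have hρk : 0 < ρ ^ (k + 1) := pow_pos h0 _
    obtain ⟨N, hN⟩ := hu (ε / ρ ^ (k + 1)) (div_pos hε hρk)
    refine ⟨N, fun m hm n hn z hz => ?_⟩
    have hlt := hN m hm n hn z hz
    have hz0 : z ≠ 0 := norm_pos_iff.1 (hsub hz).1
    rw [mem_sphere_zero_iff_norm] at hz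
    rw [dist_eq_norm, lt_div_iff₀' hρk] at hlt
    rwa [hSP m z hz0, hSP n z hz0, dist_eq_norm, ← mul_sub, norm_mul, norm_pow, hz]
  obtain ⟨Φ, hΦ⟩ := exists_tendstoLocallyUniformlyOn_ball_of_sphere hSd hCauchy
  refine ⟨Φ, (hΦ.differentiableOn (Eventually.of_forall hSd) isOpen_ball).analyticOnNhd
    isOpen_ball, fun z h0 h1 => ?_, fun m => ?_⟩
  · have hz0 : z ≠ 0 := norm_pos_iff.1 h0
    have hlim := (hF.tendsto_at (show z ∈ {z : ℂ | 0 < ‖z‖ ∧ ‖z‖ < r} from ⟨h0, h1⟩)).const_mul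
      (z ^ (k + 1))
    simp only [← hSP _ z hz0] at hlim
    rw [tendsto_nhds_unique (hΦ.tendsto_at (mem_ball_zero_iff.2 h1)) hlim]
    field_simp
  · have h0 : (0 : ℂ) ∈ ball (0 : ℂ) r := mem_ball_self hr
    refine tendsto_nhds_unique (((hΦ.iteratedDeriv_of_differentiableOn hSd isOpen_ball m).tendsto_at
      h0).div_const _) (tendsto_const_nhds.congr' ?_)
    filter_upwards [eventually_ge_atTop (m + 1)] with N hN
    exact (iteratedDeriv_sum_pow_div_factorial_mul (fun n => hG n 0 h0) hN).symm
end
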